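/- For partitions λ (with l(λ) ≤ N) written in Frobenius notation, the Giambelli identity holds for Schur polynomials: s_{(a_1,…,a_p | b_1,…,b_p)}(x) = det( s_{(a_j | b_k)}(x) )_{j,k=1}^p. -/

import Mathlib

open Matrix

/-- The Schur polynomial in `N` variables, via the bialternant formula. -/
noncomputable def schurSpec {F : Type*} [Field F] {N : ℕ} (z : Fin N → F) (lam : Fin N → ℕ) : F :=
  det (of fun j k : Fin N => z j ^ (lam k + (N - 1 - (k : ℕ)))) /
    det (of fun j k : Fin N => z j ^ (N - 1 - (k : ℕ)))

/-- `conjPart N lam i` is the `(i+1)`-st part of the conjugate partition of `lam`. -/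
def conjPart (N : ℕ) (lam : Fin N → ℕ) (i : ℕ) : ℕ :=
  (Finset.univ.filter fun j : Fin N => i < lam j).card

/-- The hook partition `(a | b) = (a + 1, 1^b)`, padded to length `N`. -/
def hookPart (N : ℕ) (a b : ℕ) : Fin N → ℕ :=
  fun i => if (i : ℕ) = 0 then a + 1 else if (i : ℕ) ≤ b then 1 else 0


lemma card_lem {N : ℕ} (P : Fin N → Prop) [DecidablePred P]
    (hP : ∀ i j : Fin N, i ≤ j → P j → P i) (k : Fin N) :
    (k : ℕ) < (Finset.univ.filter P).card ↔ P k := by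
  constructor
  · intro h
    by_contra hk
    have hsub : Finset.univ.filter P ⊆ Finset.Iio k := by
      intro i hi
      simp only [Finset.mem_filter, Finset.mem_univ, true_and] at hi
      rw [Finset.mem_Iio]
      by_contra hik
      exact hk (hP k i (not_lt.mp hik) hi)
    have := Finset.card_le_card hsub
    rw [Fin.card_Iio] at this
    omega
  · intro h
    have hsub : Finset.Iic k ⊆ Finset.univ.filter P := by
      intro i hi
      simp only [Finset.mem_filter, Finset.mem_univ, true_and]
      exact hP i k (Finset.mem_Iic.mp hi) h
    have := Finset.card_le_card hsub
    rw [Fin.card_Iic] at this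
    omega

lemma hook_det {F : Type*} [Field F] {N : ℕ} (x : Fin N → F) (a : ℕ) (b : Fin N) :
    det (of fun j k : Fin N => x j ^ (hookPart N a (b : ℕ) k + (N - 1 - (k : ℕ)))) =
      (-1) ^ (b : ℕ) * det ((of fun j k : Fin N => x j ^ (N - 1 - (k : ℕ))).updateCol b
        (fun j => x j ^ (N + a))) := by
  obtain _ | n := N
  · exact b.elim0
  have key : (of fun j k : Fin (n+1) => x j ^ (n + 1 - 1 - (k : ℕ))).updateCol b
        (fun j => x j ^ (n + 1 + a)) =
      (of fun j k : Fin (n+1) => x j ^ (hookPart (n+1) a (b : ℕ) k + (n + 1 - 1 - (k : ℕ)))).submatrix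
        id (Fin.cycleRange b) := by
    ext j k
    rw [updateCol_apply]
    simp only [submatrix_apply, of_apply, id]
    rcases lt_trichotomy k b with h | h | h
    · rw [if_neg h.ne]
      have h1 := Fin.coe_cycleRange_of_lt h
      have hb := b.2
      have h' : (k : ℕ) < b := h
      congr 1
      simp only [hookPart, h1]
      rw [if_neg (by omega), if_pos (by omega)]
      omega
    · subst h
      rw [if_pos rfl, Fin.cycleRange_self]
      congr 1
      simp [hookPart]
      omega
    · rw [if_neg h.ne', Fin.cycleRange_of_gt h]
      have h' : (b : ℕ) < k := h
      congr 1
      simp only [hookPart]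
      rw [if_neg (by omega), if_neg (by omega)]
      omega
  rw [key, det_permute', Fin.sign_cycleRange, ← mul_assoc]
  push_cast
  rw [← mul_pow]
  simp

lemma sign_lem {N p : ℕ} (σ : Equiv.Perm (Fin N))
    (h1 : ∀ i j : Fin N, i < j → (j : ℕ) < p → σ j < σ i)
    (h2 : ∀ i j : Fin N, i < j → p ≤ (i : ℕ) → σ i < σ j) :
    Equiv.Perm.sign σ = ∏ i : Fin N, if (i : ℕ) < p then (-1) ^ (σ i : ℕ) else 1 := by
  rw [Equiv.Perm.sign_eq_prod_prod_Ioi]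
  refine Finset.prod_congr rfl fun i _ => ?_
  split_ifs with hi
  · rw [Finset.prod_ite]
    simp only [Finset.prod_const, one_pow, one_mul]
    congr 1
    have : (Finset.Ioi i).filter (fun j => ¬ σ i < σ j) =
        (Finset.Iio (σ i)).map σ.symm.toEmbedding := by
      ext j
      simp only [Finset.mem_filter, Finset.mem_Ioi, Finset.mem_map_equiv, Equiv.symm_symm,
        Finset.mem_Iio, not_lt]
      constructor
      · rintro ⟨hij, hle⟩
        exact lt_of_le_of_ne hle (fun h => hij.ne' (σ.injective h))
      · intro h
        refine ⟨?_, h.le⟩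
        by_contra hij
        rcases lt_or_eq_of_le (not_lt.mp hij) with h' | h'
        · exact absurd (h1 j i h' hi) (not_lt.mpr h.le)
        · subst h'
          exact lt_irrefl _ h
    rw [this, Finset.card_map, Fin.card_Iio]
  · refine Finset.prod_eq_one fun j hj => ?_
    rw [if_pos (h2 i j (Finset.mem_Ioi.mp hj) (not_lt.mp hi))]

lemma det_lem {F : Type*} [Field F] {N p : ℕ} (hpN : p ≤ N) (C : Matrix (Fin N) (Fin N) F)
    (σ : Equiv.Perm (Fin N))
    (h1 : ∀ i j : Fin N, i < j → (j : ℕ) < p → σ j < σ i)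
    (h2 : ∀ i j : Fin N, i < j → p ≤ (i : ℕ) → σ i < σ j)
    (hC : ∀ i k : Fin N, p ≤ (k : ℕ) → C i k = if i = σ k then 1 else 0) :
    det C = det (of fun j k : Fin p => (-1) ^ (σ (Fin.castLE hpN j) : ℕ) *
      C (σ (Fin.castLE hpN j)) (Fin.castLE hpN k)) := by
  let e : Fin p ≃ {i : Fin N // (i : ℕ) < p} :=
    { toFun := fun j => ⟨Fin.castLE hpN j, j.2⟩
      invFun := fun i => ⟨i.1, i.2⟩
      left_inv := fun j => rfl
      right_inv := fun i => rfl }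
  have hD : det (C.submatrix σ id) = det (of fun j k : Fin p =>
      C (σ (Fin.castLE hpN j)) (Fin.castLE hpN k)) := by
    rw [twoBlockTriangular_det' _ (fun i : Fin N => (i : ℕ) < p)]
    · have hone : toSquareBlockProp (C.submatrix σ id) (fun i : Fin N => ¬ (i : ℕ) < p) = 1 := by
        ext i k
        rw [toSquareBlockProp_def, of_apply, submatrix_apply, id, hC _ _ (not_lt.mp k.2),
          one_apply]
        simp [Subtype.ext_iff]
      rw [hone, det_one, mul_one, ← det_submatrix_equiv_self e]
      rfl
    · intro i hi j hj
      rw [submatrix_apply, id, hC _ _ (not_lt.mp hj), if_neg]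
      intro h
      have := σ.injective h
      subst this
      exact hj hi
  have hs : ((Equiv.Perm.sign σ : ℤ) : F) = ∏ j : Fin p, (-1 : F) ^ (σ (Fin.castLE hpN j) : ℕ) := by
    rw [sign_lem σ h1 h2]
    rw [← Finset.prod_filter, Finset.prod_subtype (p := fun i : Fin N => (i : ℕ) < p) _ (by simp),
      ← e.prod_comp]
    · simp [e]
  have h3 := det_permute σ C
  have hmul := det_mul_column (fun j : Fin p => (-1 : F) ^ (σ (Fin.castLE hpN j) : ℕ))
    (of fun j k : Fin p => C (σ (Fin.castLE hpN j)) (Fin.castLE hpN k))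
  simp only [of_apply] at hmul
  rw [hmul, ← hs, ← hD, h3, ← mul_assoc, ← Int.cast_mul, ← Units.val_mul, Int.units_mul_self]
  simp

theorem giambelli_schur {F : Type*} [Field F] (N : ℕ) (x : Fin N → F)
    (hden : det (of fun j k : Fin N => x j ^ (N - 1 - (k : ℕ))) ≠ 0)
    (lam : Fin N → ℕ) (hlam : Antitone lam)
    (p : ℕ) (hpN : p ≤ N)
    (hp : p = (Finset.univ.filter fun j : Fin N => (j : ℕ) < lam j).card)
    (a b : Fin p → ℕ)
    (ha : ∀ j : Fin p, a j = lam (Fin.castLE hpN j) - ((j : ℕ) + 1))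
    (hb : ∀ j : Fin p, b j = conjPart N lam (j : ℕ) - ((j : ℕ) + 1)) :
    schurSpec x lam =
      det (of fun j k : Fin p => schurSpec x (hookPart N (a j) (b k))) := by
  have hP1 : ∀ k : Fin N, (k : ℕ) < p ↔ (k : ℕ) < lam k := by
    intro k
    rw [hp]
    refine card_lem (fun j : Fin N => (j : ℕ) < lam j) ?_ k
    intro i j hij h
    have := hlam hij
    have hij' : (i : ℕ) ≤ j := hij
    omega
  have hP2 : ∀ (i : ℕ) (k : Fin N), (k : ℕ) < conjPart N lam i ↔ i < lam k := by
    intro i k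
    refine card_lem (fun j : Fin N => i < lam j) ?_ k
    intro i j hij h
    exact lt_of_lt_of_le h (hlam hij)
  have hcN : ∀ i, conjPart N lam i ≤ N := by
    intro i
    exact (Finset.card_le_univ _).trans (by simp)
  have hcanti : ∀ i j, i ≤ j → conjPart N lam j ≤ conjPart N lam i := by
    intro i j hij
    refine Finset.card_le_card (Finset.monotone_filter_right _ ?_)
    intro k _ hk
    exact lt_of_le_of_lt hij hk
  have hcgt : ∀ k : Fin N, (k : ℕ) < p → (k : ℕ) < conjPart N lam k := fun k hk =>
    (hP2 k k).2 ((hP1 k).1 hk)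
  let f : Fin N → Fin N := fun k =>
    if (k : ℕ) < p then ⟨conjPart N lam k - (k + 1), by have := hcN k; have := k.2; omega⟩
    else ⟨k - lam k, by have := k.2; omega⟩
  have f1 : ∀ k : Fin N, (k : ℕ) < p → (f k : ℕ) = conjPart N lam k - (k + 1) := by
    intro k hk
    simp [f, hk]
  have f2 : ∀ k : Fin N, p ≤ (k : ℕ) → (f k : ℕ) = k - lam k := by
    intro k hk
    simp [f, not_lt.mpr hk]
  have h1 : ∀ i j : Fin N, i < j → (j : ℕ) < p → f j < f i := by
    intro i j hij hj
    have hij' : (i : ℕ) < j := hij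
    rw [Fin.lt_def, f1 j hj, f1 i (by omega)]
    have := hcanti i j hij'.le
    have := hcgt j hj
    omega
  have h2 : ∀ i j : Fin N, i < j → p ≤ (i : ℕ) → f i < f j := by
    intro i j hij hi
    have hij' : (i : ℕ) < j := hij
    rw [Fin.lt_def, f2 i hi, f2 j (by omega)]
    have := hlam hij.le
    have := hP1 i
    omega
  have h3 : ∀ i j : Fin N, (i : ℕ) < p → p ≤ (j : ℕ) → f i ≠ f j := by
    intro i j hi hj h
    have h' := congrArg Fin.val h
    rw [f1 i hi, f2 j hj] at h'
    have e1 := hcgt i hi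
    have e2 := hP1 j
    have e3 := hP2 i j
    omega
  have hinj : Function.Injective f := by
    have aux : ∀ i j : Fin N, i < j → f i ≠ f j := by
      intro i j hij
      by_cases hj : (j : ℕ) < p
      · exact (h1 i j hij hj).ne'
      · by_cases hi : (i : ℕ) < p
        · exact h3 i j hi (not_lt.mp hj)
        · exact (h2 i j hij (not_lt.mp hi)).ne
    intro i j h
    rcases lt_trichotomy i j with hij | hij | hij
    · exact absurd h (aux i j hij)
    · exact hij
    · exact absurd h.symm (aux j i hij)
  let σ : Equiv.Perm (Fin N) := Equiv.ofBijective f (Finite.injective_iff_bijective.mp hinj)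
  have hσ : ∀ k, σ k = f k := fun k => rfl
  set V : Matrix (Fin N) (Fin N) F := of fun j k : Fin N => x j ^ (N - 1 - (k : ℕ)) with hV
  set M : Matrix (Fin N) (Fin N) F :=
    of fun j k : Fin N => x j ^ (lam k + (N - 1 - (k : ℕ))) with hM
  have hu : IsUnit V.det := isUnit_iff_ne_zero.mpr hden
  have hC : ∀ i k : Fin N, p ≤ (k : ℕ) → (V⁻¹ * M) i k = if i = σ k then 1 else 0 := by
    intro i k hk
    have : (V⁻¹ * M) i k = (V⁻¹ * V) i (σ k) := by
      rw [mul_apply, mul_apply]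
      refine Finset.sum_congr rfl fun j _ => ?_
      congr 1
      simp only [hM, hV, of_apply]
      congr 1
      rw [hσ, f2 k hk]
      have := hP1 k
      have := k.2
      omega
    rw [this, nonsing_inv_mul _ hu, one_apply]
  have hdet := det_lem hpN (V⁻¹ * M) σ h1 h2 hC
  have hL : schurSpec x lam = det (V⁻¹ * M) := by
    rw [det_mul, det_nonsing_inv, Ring.inverse_eq_inv', schurSpec, div_eq_inv_mul]
  rw [hL, hdet, ← det_transpose]
  congr 1
  ext j k
  simp only [transpose_apply, of_apply]
  have hbk : b k = (f (Fin.castLE hpN k) : ℕ) := by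
    rw [hb, f1 _ k.2]
    rfl
  rw [hσ, hbk, schurSpec, hook_det]
  have hcol : (fun i => M i (Fin.castLE hpN j)) = fun i => x i ^ (N + a j) := by
    funext i
    simp only [hM, of_apply]
    congr 1
    rw [ha]
    have e1 := (hP1 (Fin.castLE hpN j)).1 j.2
    have := j.2
    simp only [Fin.val_castLE] at e1 ⊢
    omega
  have hcr := congrFun (det_smul_inv_mulVec_eq_cramer V (fun i => x i ^ (N + a j)) hu)
    (f (Fin.castLE hpN k))
  rw [cramer_apply] at hcr
  rw [← hV, ← hcr, ← hcol]
  simp only [Pi.smul_apply, smul_eq_mul]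
  rw [mul_div_assoc, mul_div_cancel_left₀ _ hden]
  rfl
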